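/- arXiv:2510.25363 — 3 statements merged into one kernel-verified Lean document; each statement's English description precedes it below -/
import Mathlib

section
/- Let H be a real inner product space, K ⊆ H nonempty, closed and convex, T : K → K nonexpansive, and f : K → K a β-contraction with β ∈ [0,1). Let (α_k)_{k≥1} ⊂ (0,1] and let (x_k) be the viscosity Halpern iteration x_{k+1} = α_{k+1} f(x_k) + (1 − α_{k+1}) T(x_k) with x_0 ∈ K. If the sequence (α_k) is nonincreasing, then for every k ≥ 1, ‖x_{k+1} − x_k‖ ≤ (1 − α_{k+1}(1 − β)) ‖x_k − x_{k−1}‖ + (α_k − α_{k+1}) ‖f(x_{k−1}) − T x_{k−1}‖. -/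
/-- Key recursion for the viscosity Halpern iteration in a real inner product space:
if the step sizes `(α_k) ⊂ (0,1]` are nonincreasing, then for every `k ≥ 1`,
`‖x_{k+1} - x_k‖ ≤ (1 - α_{k+1}(1-β)) ‖x_k - x_{k-1}‖ + (α_k - α_{k+1}) ‖f(x_{k-1}) - T x_{k-1}‖`. -/
theorem viscosity_halpern_key_recursion
    {H : Type*} [NormedAddCommGroup H] [InnerProductSpace ℝ H]
    (K : Set H) (hKne : K.Nonempty) (hKcl : IsClosed K) (hKcv : Convex ℝ K)
    (T f : H → H) (hTK : ∀ y ∈ K, T y ∈ K) (hfK : ∀ y ∈ K, f y ∈ K)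
    (hT : ∀ y ∈ K, ∀ w ∈ K, ‖T y - T w‖ ≤ ‖y - w‖)
    (β : ℝ) (hβ0 : 0 ≤ β) (hβ1 : β < 1)
    (hf : ∀ y ∈ K, ∀ w ∈ K, ‖f y - f w‖ ≤ β * ‖y - w‖)
    (α : ℕ → ℝ) (hα : ∀ k, 1 ≤ k → α k ∈ Set.Ioc (0 : ℝ) 1)
    (hαmono : ∀ k, 1 ≤ k → α (k + 1) ≤ α k)
    (x : ℕ → H) (hx0 : x 0 ∈ K)
    (hx : ∀ k, x (k + 1) = α (k + 1) • f (x k) + (1 - α (k + 1)) • T (x k)) :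
    ∀ k, 1 ≤ k →
      ‖x (k + 1) - x k‖ ≤
        (1 - α (k + 1) * (1 - β)) * ‖x k - x (k - 1)‖ +
          (α k - α (k + 1)) * ‖f (x (k - 1)) - T (x (k - 1))‖ := by
  have hxK : ∀ n, x n ∈ K := by
    intro n
    induction n with
    | zero => exact hx0
    | succ n ih =>
      obtain ⟨h0, h1⟩ := hα (n + 1) (by omega)
      rw [hx n]
      exact hKcv (hfK _ ih) (hTK _ ih) h0.le (sub_nonneg.2 h1) (by ring)
  intro k hk
  obtain ⟨n, rfl⟩ := Nat.exists_eq_add_of_le' hk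
  rw [Nat.add_sub_cancel]
  obtain ⟨h0, h1⟩ := hα (n + 1 + 1) (by omega)
  have hmono := hαmono (n + 1) hk
  have hdecomp : x (n + 1 + 1) - x (n + 1) =
      α (n + 1 + 1) • (f (x (n + 1)) - f (x n)) +
        (1 - α (n + 1 + 1)) • (T (x (n + 1)) - T (x n)) -
          (α (n + 1) - α (n + 1 + 1)) • (f (x n) - T (x n)) := by
    have hn : x (n + 1 + 1) - x (n + 1) =
        (α (n + 1 + 1) • f (x (n + 1)) + (1 - α (n + 1 + 1)) • T (x (n + 1))) -
          (α (n + 1) • f (x n) + (1 - α (n + 1)) • T (x n)) := by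
      rw [← hx, ← hx]
    rw [hn]
    module
  have hfn := mul_le_mul_of_nonneg_left (hf _ (hxK (n + 1)) _ (hxK n)) h0.le
  have hTn := mul_le_mul_of_nonneg_left (hT _ (hxK (n + 1)) _ (hxK n)) (sub_nonneg.2 h1)
  rw [hdecomp]
  refine (norm_sub_le _ _).trans ((add_le_add_left (norm_add_le _ _) _).trans ?_)
  rw [norm_smul_of_nonneg h0.le, norm_smul_of_nonneg (sub_nonneg.2 h1),
    norm_smul_of_nonneg (sub_nonneg.2 hmono)]
  linarith
end

section
/- Let H be a real inner product space, K ⊆ H nonempty, closed and convex, T : K → K nonexpansive, f : K → K a β-contraction with β ∈ [0,1), and x̄ ∈ K a fixed point of T with z := f(x̄). For k ≥ 1 set α_k := min{2/((1−β)k), 1}, and let (x_k) be the viscosity Halpern iteration x_{k+1} = α_{k+1} f(x_k) + (1 − α_{k+1}) T(x_k) with x_0 ∈ K. Then for every k ≥ 1, ‖x_k − x_{k−1}‖ ≤ 2 J C_x̄ / ((1−β) k), where C_x̄ := max{‖x_0 − x̄‖, ‖z − x̄‖/(1 − β)} and J := ⌈2/(1−β)⌉. -/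
/-- Boundedness of the viscosity Halpern iteration around a fixed point. -/
theorem viscosity_halpern_mem_and_bounded
    {H : Type*} [NormedAddCommGroup H] [NormedSpace ℝ H]
    {K : Set H} (hKcv : Convex ℝ K) {T f : H → H}
    (hTK : ∀ y ∈ K, T y ∈ K) (hfK : ∀ y ∈ K, f y ∈ K)
    {α : ℕ → ℝ} (hα0 : ∀ k, 0 ≤ α (k + 1)) (hα1 : ∀ k, α (k + 1) ≤ 1)
    {xbar : H} {C : ℝ}
    (hTC : ∀ y ∈ K, ‖y - xbar‖ ≤ C → ‖T y - xbar‖ ≤ C)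
    (hfC : ∀ y ∈ K, ‖y - xbar‖ ≤ C → ‖f y - xbar‖ ≤ C)
    {x : ℕ → H} (hx0 : x 0 ∈ K) (hxC : ‖x 0 - xbar‖ ≤ C)
    (hx : ∀ k, x (k + 1) = α (k + 1) • f (x k) + (1 - α (k + 1)) • T (x k)) (k : ℕ) :
    x k ∈ K ∧ ‖x k - xbar‖ ≤ C := by
  induction k with
  | zero => exact ⟨hx0, hxC⟩
  | succ k ih =>
    obtain ⟨hk, hkC⟩ := ih
    have h0 := hα0 k
    have h1 : 0 ≤ 1 - α (k + 1) := sub_nonneg.2 (hα1 k)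
    rw [hx k]
    refine ⟨hKcv (hfK _ hk) (hTK _ hk) h0 h1 (by ring), ?_⟩
    simpa only [mem_closedBall_iff_norm] using
      convex_closedBall xbar C (mem_closedBall_iff_norm.2 (hfC _ hk hkC))
        (mem_closedBall_iff_norm.2 (hTC _ hk hkC)) h0 h1 (by ring)

/-- Recursive estimate for the difference of two consecutive viscosity Halpern steps. -/
theorem norm_viscosity_step_sub_le
    {H : Type*} [NormedAddCommGroup H] [NormedSpace ℝ H]
    {a b β D : ℝ} (hb0 : 0 ≤ b) (hb1 : b ≤ 1) {p q p' q' u v : H}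
    (hp : ‖p' - p‖ ≤ β * ‖v - u‖) (hq : ‖q' - q‖ ≤ ‖v - u‖) (hD : ‖p - q‖ ≤ D) :
    ‖(b • p' + (1 - b) • q') - (a • p + (1 - a) • q)‖ ≤
      (1 - (1 - β) * b) * ‖v - u‖ + |b - a| * D := by
  have hdecomp : (b • p' + (1 - b) • q') - (a • p + (1 - a) • q) =
      b • (p' - p) + (1 - b) • (q' - q) + (b - a) • (p - q) := by module
  have h1 : 0 ≤ 1 - b := sub_nonneg.2 hb1
  calc _ ≤ ‖b • (p' - p)‖ + ‖(1 - b) • (q' - q)‖ + ‖(b - a) • (p - q)‖ :=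
        hdecomp ▸ norm_add₃_le
    _ = b * ‖p' - p‖ + (1 - b) * ‖q' - q‖ + |b - a| * ‖p - q‖ := by
        simp only [norm_smul, Real.norm_eq_abs, abs_of_nonneg hb0, abs_of_nonneg h1]
    _ ≤ b * (β * ‖v - u‖) + (1 - b) * ‖v - u‖ + |b - a| * D := by gcongr
    _ = _ := by ring

/-- **O(1/k) convergence rate of the viscosity Halpern iteration** in a real inner
product space, with step sizes `α_k = min{2/((1-β)k), 1}`: for every `k ≥ 1`,
`‖x_k - x_{k-1}‖ ≤ 2 J C_x̄ / ((1-β) k)`, where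
`C_x̄ := max{‖x_0 - x̄‖, ‖z - x̄‖/(1-β)}`, `z := f(x̄)` and `J := ⌈2/(1-β)⌉`. -/
theorem viscosity_halpern_step_rate
    {H : Type*} [NormedAddCommGroup H] [InnerProductSpace ℝ H]
    (K : Set H) (hKne : K.Nonempty) (hKcl : IsClosed K) (hKcv : Convex ℝ K)
    (T f : H → H) (hTK : ∀ y ∈ K, T y ∈ K) (hfK : ∀ y ∈ K, f y ∈ K)
    (hT : ∀ y ∈ K, ∀ w ∈ K, ‖T y - T w‖ ≤ ‖y - w‖)
    (β : ℝ) (hβ0 : 0 ≤ β) (hβ1 : β < 1)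
    (hf : ∀ y ∈ K, ∀ w ∈ K, ‖f y - f w‖ ≤ β * ‖y - w‖)
    (xbar : H) (hxbarK : xbar ∈ K) (hfix : T xbar = xbar)
    (α : ℕ → ℝ)
    (hα : ∀ k, 1 ≤ k → α k = min (2 / ((1 - β) * k)) 1)
    (x : ℕ → H) (hx0 : x 0 ∈ K)
    (hx : ∀ k, x (k + 1) = α (k + 1) • f (x k) + (1 - α (k + 1)) • T (x k)) :
    ∀ k, 1 ≤ k →
      ‖x k - x (k - 1)‖ ≤
        2 * (⌈2 / (1 - β)⌉₊ : ℝ) * max ‖x 0 - xbar‖ (‖f xbar - xbar‖ / (1 - β)) /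
          ((1 - β) * k) := by
  set C := max ‖x 0 - xbar‖ (‖f xbar - xbar‖ / (1 - β)) with hC
  set J := ⌈2 / (1 - β)⌉₊
  have hγ : 0 < 1 - β := sub_pos.2 hβ1
  have hC0 : 0 ≤ C := (norm_nonneg _).trans (le_max_left _ _)
  have hfxC : ‖f xbar - xbar‖ ≤ C * (1 - β) := (div_le_iff₀ hγ).1 (le_max_right _ _)
  have hTC : ∀ y ∈ K, ‖y - xbar‖ ≤ C → ‖T y - xbar‖ ≤ C := fun y hy h ↦ by
    simpa only [hfix] using (hT y hy xbar hxbarK).trans h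
  have hfC : ∀ y ∈ K, ‖y - xbar‖ ≤ C → ‖f y - xbar‖ ≤ C := fun y hy h ↦ by
    have h1 := norm_sub_le_norm_sub_add_norm_sub (f y) (f xbar) xbar
    have h2 := hf y hy xbar hxbarK
    have h3 := mul_le_mul_of_nonneg_left h hβ0
    linarith
  have hα0 : ∀ k, 0 ≤ α (k + 1) := fun k ↦ by
    rw [hα (k + 1) (by omega)]
    positivity
  have hα1 : ∀ k, α (k + 1) ≤ 1 := fun k ↦ by
    rw [hα (k + 1) (by omega)]
    exact min_le_right _ _
  have hbdd := viscosity_halpern_mem_and_bounded hKcv hTK hfK hα0 hα1 hTC hfC hx0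
    (le_max_left _ _) hx
  have hdiam : ∀ {u v : H}, ‖u - xbar‖ ≤ C → ‖v - xbar‖ ≤ C → ‖u - v‖ ≤ 2 * C :=
    fun {u v} hu hv ↦ by
      have h := norm_sub_le (u - xbar) (v - xbar)
      rw [sub_sub_sub_cancel_right] at h
      linarith
  have hJ : 2 / (1 - β) ≤ J := Nat.le_ceil _
  have hJ2 : (2 : ℝ) ≤ J := (le_div_self zero_le_two hγ (by linarith)).trans hJ
  have hαJ : ∀ k, 1 ≤ k → J ≤ k → α k = 2 / ((1 - β) * k) := fun k hk hJk ↦ by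
    have hk0 : (0 : ℝ) < k := by exact_mod_cast hk
    have h : 2 / (1 - β) ≤ k := hJ.trans (by exact_mod_cast hJk)
    rw [hα k hk, min_eq_left]
    rwa [← div_div, div_le_one hk0]
  have hsmall : ∀ k, 1 ≤ k → k ≤ J → ‖x k - x (k - 1)‖ ≤ 2 * J * C / ((1 - β) * k) :=
    fun k hk hkJ ↦ by
      have hk0 : (0 : ℝ) < k := by exact_mod_cast hk
      have hkJ' : (k : ℝ) ≤ J := by exact_mod_cast hkJ
      refine (hdiam (hbdd k).2 (hbdd (k - 1)).2).trans ?_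
      rw [le_div_iff₀ (by positivity)]
      have h : (1 - β) * k ≤ J :=
        (mul_le_of_le_one_left hk0.le (by linarith)).trans hkJ'
      nlinarith
  intro k hk
  induction k, hk using Nat.le_induction with
  | base => exact hsmall 1 le_rfl (by exact_mod_cast one_le_two.trans hJ2)
  | succ k hk ih =>
    rcases le_or_gt (k + 1) J with hkJ | hkJ
    · exact hsmall _ (by omega) hkJ
    obtain ⟨m, rfl⟩ : ∃ m, k = m + 1 := ⟨k - 1, by omega⟩
    simp only [Nat.add_sub_cancel] at ih ⊢
    have ha := hαJ (m + 1) hk (by omega)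
    have hb := hαJ (m + 1 + 1) (by omega) (by omega)
    have hstep := norm_viscosity_step_sub_le (a := α (m + 1)) (hα0 (m + 1)) (hα1 (m + 1))
      (hf _ (hbdd (m + 1)).1 _ (hbdd m).1) (hT _ (hbdd (m + 1)).1 _ (hbdd m).1)
      (hdiam (hfC _ (hbdd m).1 (hbdd m).2) (hTC _ (hbdd m).1 (hbdd m).2))
    rw [← hx (m + 1), ← hx m, ha, hb] at hstep
    refine hstep.trans ?_
    push_cast at ih ⊢
    have hm : (0 : ℝ) ≤ m := m.cast_nonneg
    have hcoef : 1 - (1 - β) * (2 / ((1 - β) * ((m : ℝ) + 1 + 1))) = m / (m + 2) := by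
      field_simp
      ring
    have habs : |2 / ((1 - β) * ((m : ℝ) + 1 + 1)) - 2 / ((1 - β) * (m + 1))| =
        2 / ((1 - β) * (m + 1) * (m + 2)) := by
      rw [abs_sub_comm, abs_of_nonneg]
      · field_simp
        ring
      · rw [sub_nonneg]
        gcongr
        linarith
    rw [hcoef, habs]
    calc _ ≤ m / (m + 2) * (2 * J * C / ((1 - β) * (m + 1))) +
          2 / ((1 - β) * (m + 1) * (m + 2)) * (2 * C) := by gcongr
      _ = (m * J + 2) * (2 * C / ((1 - β) * (m + 1) * (m + 2))) := by
          field_simp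
      _ ≤ (m * J + J) * (2 * C / ((1 - β) * (m + 1) * (m + 2))) := by gcongr
      _ = 2 * J * C / ((1 - β) * (m + 1 + 1)) := by
          field_simp
          ring
end

section
/- Let H be a real inner product space, K ⊆ H nonempty, closed and convex, T : K → K nonexpansive, f : K → K a β-contraction with β ∈ [0,1), and x̄ ∈ K a fixed point of T with z := f(x̄). For k ≥ 1 set α_k := min{2/((1−β)k), 1}, and let (x_k) be the viscosity Halpern iteration x_{k+1} = α_{k+1} f(x_k) + (1 − α_{k+1}) T(x_k) with x_0 ∈ K. Then for every k ≥ 1, ‖T x_{k−1} − x_{k−1}‖ ≤ 2 C_x̄ (J + 2) / ((1−β) k), where C_x̄ := max{‖x_0 − x̄‖, ‖z − x̄‖/(1 − β)} and J := ⌈2/(1−β)⌉; in particular the rate of asymptotic regularity of the iteration is O(1/k). -/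
/-- A convex combination of a nonexpansive displacement, a contractive displacement and a
perturbation coming from the change of step size. -/
lemma norm_viscosity_step_sub_le_s13 {H : Type*} [NormedAddCommGroup H] [NormedSpace ℝ H]
    {a b β d M : ℝ} {u u' v v' : H} (ha0 : 0 ≤ a) (ha1 : a ≤ 1) (hab : a ≤ b)
    (hu : ‖u' - u‖ ≤ β * d) (hv : ‖v' - v‖ ≤ d) (huv : ‖u - v‖ ≤ M) :
    ‖(a • u' + (1 - a) • v') - (b • u + (1 - b) • v)‖ ≤
      (1 - (1 - β) * a) * d + (b - a) * M := by
  have key : (a • u' + (1 - a) • v') - (b • u + (1 - b) • v) =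
      a • (u' - u) + (1 - a) • (v' - v) - (b - a) • (u - v) := by module
  rw [key]
  have h1 := norm_sub_le (a • (u' - u) + (1 - a) • (v' - v)) ((b - a) • (u - v))
  have h2 := norm_add_le (a • (u' - u)) ((1 - a) • (v' - v))
  rw [norm_smul_of_nonneg ha0, norm_smul_of_nonneg (sub_nonneg.2 ha1)] at h2
  rw [norm_smul_of_nonneg (sub_nonneg.2 hab)] at h1
  have h3 := mul_le_mul_of_nonneg_left hu ha0
  have h4 := mul_le_mul_of_nonneg_left hv (sub_nonneg.2 ha1)
  have h5 := mul_le_mul_of_nonneg_left huv (sub_nonneg.2 hab)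
  linarith

/-- A sequence bounded by `M` and satisfying the perturbed contraction recursion with step
sizes `2 / (c k)` from index `J` on decays like `M J / (c k)`. -/
lemma mul_succ_mul_le_of_recursion {c M : ℝ} {J : ℕ} {a : ℕ → ℝ} (hc0 : 0 < c) (hc1 : c ≤ 1)
    (hM : 0 ≤ M) (hJ : 2 ≤ J) (ha : ∀ k, a k ≤ M)
    (hrec : ∀ k, J ≤ k + 1 → a (k + 1) ≤ (1 - c * (2 / (c * (k + 2)))) * a k +
      (2 / (c * (k + 1)) - 2 / (c * (k + 2))) * M) (k : ℕ) :
    c * (k + 1) * a k ≤ M * J := by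
  have small : ∀ n : ℕ, n + 1 ≤ J → c * (n + 1) * a n ≤ M * J := fun n hn => by
    have hn' : (n : ℝ) + 1 ≤ J := by exact_mod_cast hn
    calc c * (n + 1) * a n ≤ c * (n + 1) * M := by gcongr; exact ha n
      _ ≤ 1 * J * M := by gcongr
      _ = M * J := by ring
  induction k with
  | zero => exact small 0 (by omega)
  | succ k ih =>
    by_cases hk : k + 2 ≤ J
    · exact small (k + 1) hk
    have hJ' : (2 : ℝ) ≤ J := by exact_mod_cast hJ
    have hpos : (0 : ℝ) < k + 1 := by positivity
    have h := mul_le_mul_of_nonneg_left (hrec k (by omega))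
      (by positivity : 0 ≤ c * ((k : ℝ) + 1) * (k + 2))
    have e : c * ((k : ℝ) + 1) * (k + 2) * ((1 - c * (2 / (c * (k + 2)))) * a k +
        (2 / (c * (k + 1)) - 2 / (c * (k + 2))) * M) =
        k * (c * (k + 1) * a k) + 2 * M := by
      field_simp
      ring
    rw [e] at h
    have h' := mul_le_mul_of_nonneg_left ih (Nat.cast_nonneg (α := ℝ) k)
    have hMJ := mul_le_mul_of_nonneg_left hJ' hM
    push_cast
    refine le_of_mul_le_mul_left ?_ hpos
    linarith

/-- **O(1/k) rate of asymptotic regularity of the viscosity Halpern iteration** in a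
real inner product space, with step sizes `α_k = min{2/((1-β)k), 1}`: for every `k ≥ 1`,
`‖T x_{k-1} - x_{k-1}‖ ≤ 2 C_x̄ (J+2) / ((1-β) k)`, where
`C_x̄ := max{‖x_0 - x̄‖, ‖z - x̄‖/(1-β)}`, `z := f(x̄)` and `J := ⌈2/(1-β)⌉`. -/
theorem viscosity_halpern_asymptotic_regularity_rate
    {H : Type*} [NormedAddCommGroup H] [InnerProductSpace ℝ H]
    (K : Set H) (hKne : K.Nonempty) (hKcl : IsClosed K) (hKcv : Convex ℝ K)
    (T f : H → H) (hTK : ∀ y ∈ K, T y ∈ K) (hfK : ∀ y ∈ K, f y ∈ K)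
    (hT : ∀ y ∈ K, ∀ w ∈ K, ‖T y - T w‖ ≤ ‖y - w‖)
    (β : ℝ) (hβ0 : 0 ≤ β) (hβ1 : β < 1)
    (hf : ∀ y ∈ K, ∀ w ∈ K, ‖f y - f w‖ ≤ β * ‖y - w‖)
    (xbar : H) (hxbarK : xbar ∈ K) (hfix : T xbar = xbar)
    (α : ℕ → ℝ)
    (hα : ∀ k, 1 ≤ k → α k = min (2 / ((1 - β) * k)) 1)
    (x : ℕ → H) (hx0 : x 0 ∈ K)
    (hx : ∀ k, x (k + 1) = α (k + 1) • f (x k) + (1 - α (k + 1)) • T (x k)) :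
    ∀ k, 1 ≤ k →
      ‖T (x (k - 1)) - x (k - 1)‖ ≤
        2 * max ‖x 0 - xbar‖ (‖f xbar - xbar‖ / (1 - β)) *
          ((⌈2 / (1 - β)⌉₊ : ℝ) + 2) / ((1 - β) * k) := by
  set C := max ‖x 0 - xbar‖ (‖f xbar - xbar‖ / (1 - β)) with hC
  set J := ⌈2 / (1 - β)⌉₊ with hJdef
  have hc0 : 0 < 1 - β := sub_pos.2 hβ1
  have hC0 : 0 ≤ C := (norm_nonneg _).trans (le_max_left _ _)
  have hz : ‖f xbar - xbar‖ ≤ (1 - β) * C := by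
    rw [mul_comm, ← div_le_iff₀ hc0]
    exact le_max_right _ _
  have hα0 : ∀ k, 0 ≤ α (k + 1) := fun k => by
    rw [hα _ (by omega)]
    positivity
  have hα1 : ∀ k, α (k + 1) ≤ 1 := fun k => by
    rw [hα _ (by omega)]
    exact min_le_right _ _
  have hxK : ∀ k, x k ∈ K := fun k => by
    induction k with
    | zero => exact hx0
    | succ k ih =>
      rw [hx]
      exact hKcv (hfK _ ih) (hTK _ ih) (hα0 k) (sub_nonneg.2 (hα1 k)) (by ring)
  have hTx : ∀ k, ‖T (x k) - xbar‖ ≤ ‖x k - xbar‖ := fun k => by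
    simpa only [hfix] using hT _ (hxK k) _ hxbarK
  have hfx : ∀ k, ‖x k - xbar‖ ≤ C → ‖f (x k) - xbar‖ ≤ C := fun k hk => by
    have h1 := norm_sub_le_norm_sub_add_norm_sub (f (x k)) (f xbar) xbar
    have h2 := hf _ (hxK k) _ hxbarK
    have h3 := mul_le_mul_of_nonneg_left hk hβ0
    linarith
  have hxC : ∀ k, ‖x k - xbar‖ ≤ C := fun k => by
    induction k with
    | zero => exact le_max_left _ _
    | succ k ih =>
      have h := convex_closedBall xbar C (mem_closedBall_iff_norm.2 (hfx k ih))
        (mem_closedBall_iff_norm.2 ((hTx k).trans ih)) (hα0 k) (sub_nonneg.2 (hα1 k)) (by ring)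
      rw [hx]
      exact mem_closedBall_iff_norm.1 h
  have hdiam : ∀ {u v : H}, ‖u - xbar‖ ≤ C → ‖v - xbar‖ ≤ C → ‖u - v‖ ≤ 2 * C := by
    intro u v hu hv
    have h := norm_sub_le_norm_sub_add_norm_sub u xbar v
    rw [norm_sub_rev xbar v] at h
    linarith
  have hfT : ∀ k, ‖f (x k) - T (x k)‖ ≤ 2 * C := fun k =>
    hdiam (hfx k (hxC k)) ((hTx k).trans (hxC k))
  have hJ : 2 ≤ J := by
    have h : (2 : ℝ) ≤ J := le_trans (by rw [le_div_iff₀ hc0]; linarith) (Nat.le_ceil _)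
    exact_mod_cast h
  have hαJ : ∀ k : ℕ, J ≤ k + 1 → α (k + 1) = 2 / ((1 - β) * (k + 1)) := fun k hk => by
    have h : 2 / (1 - β) ≤ (k : ℝ) + 1 := by exact_mod_cast Nat.ceil_le.1 hk
    rw [hα _ (by omega)]
    push_cast
    refine min_eq_left ?_
    rw [← div_div]
    exact div_le_one_of_le₀ h (by positivity)
  have hrate := mul_succ_mul_le_of_recursion (a := fun k => ‖x (k + 1) - x k‖) hc0
    (by linarith) (by positivity : 0 ≤ 2 * C) hJ (fun k => hdiam (hxC _) (hxC _))
    (fun k hk => by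
      have e1 := hαJ k hk
      have e2 := hαJ (k + 1) (by omega)
      have e3 : ((k + 1 : ℕ) : ℝ) + 1 = k + 2 := by push_cast; ring
      rw [e3] at e2
      rw [← e1, ← e2]
      have hmono : α (k + 1 + 1) ≤ α (k + 1) := by
        rw [e1, e2]
        gcongr
        norm_num
      have h := norm_viscosity_step_sub_le_s13 (hα0 (k + 1)) (hα1 (k + 1)) hmono
        (hf _ (hxK (k + 1)) _ (hxK k)) (hT _ (hxK (k + 1)) _ (hxK k)) (hfT k)
      rwa [← hx, ← hx] at h)
  intro k hk
  obtain ⟨n, rfl⟩ := Nat.exists_eq_add_of_le' hk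
  have hn : (0 : ℝ) < (1 - β) * ((n + 1 : ℕ) : ℝ) := by positivity
  rw [Nat.add_sub_cancel, le_div_iff₀ hn]
  have hdecomp : T (x n) - x n = (x (n + 1) - x n) - α (n + 1) • (f (x n) - T (x n)) := by
    rw [hx]
    module
  have h1 := norm_sub_le (x (n + 1) - x n) (α (n + 1) • (f (x n) - T (x n)))
  rw [← hdecomp, norm_smul_of_nonneg (hα0 n)] at h1
  have h2 : α (n + 1) * ((1 - β) * ((n + 1 : ℕ) : ℝ)) ≤ 2 := by
    rw [← le_div_iff₀ hn, hα _ hk]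
    exact min_le_left _ _
  have h3 := hrate n
  have h4 := mul_le_mul_of_nonneg_right h1 hn.le
  have h5 := mul_le_mul h2 (hfT n) (norm_nonneg _) zero_le_two
  push_cast at h4 h5 ⊢
  linarith
end
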